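/- arXiv:math/0005082 — 2 statements merged into one kernel-verified Lean document; each statement's English description precedes it below -/
import Mathlib

section
/- Fix z₀ ∈ ρ(A) and define Γ̂(z) := τ∘((G(z₀)+G(z₀*))/2 − G(z)) : X′ → X for z ∈ ρ(A). Then Γ̂ is a bounded conjugate-linear operator-valued map satisfying Γ̂(z) − Γ̂(w) = (z−w)·Ğ(w)∘G(z) for all z, w ∈ ρ(A). -/
open scoped ComplexConjugate

/-- `G(z) := C_H⁻¹ ∘ Ğ(z*)′`, with `Ğ(z) = τ ∘ R(z)`. -/
noncomputable def Gop
    {H : Type*} [NormedAddCommGroup H] [InnerProductSpace ℂ H] [CompleteSpace H]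
    {D : Type*} [NormedAddCommGroup D] [NormedSpace ℂ D]
    {X : Type*} [NormedAddCommGroup X] [NormedSpace ℂ X]
    (R : ℂ → (H →L[ℂ] D)) (τ : D →L[ℂ] X) (z : ℂ) (ℓ : X →L[ℂ] ℂ) : H :=
  (InnerProductSpace.toDual ℂ H).symm (ℓ.comp (τ.comp (R (conj z))))

section Gop

variable {H : Type*} [NormedAddCommGroup H] [InnerProductSpace ℂ H] [CompleteSpace H]
  {D : Type*} [NormedAddCommGroup D] [NormedSpace ℂ D]
  {X : Type*} [NormedAddCommGroup X] [NormedSpace ℂ X]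

theorem inner_Gop (R : ℂ → (H →L[ℂ] D)) (τ : D →L[ℂ] X) (z : ℂ) (ℓ : X →L[ℂ] ℂ) (h : H) :
    inner ℂ (Gop R τ z ℓ) h = ℓ (τ (R (conj z) h)) := by
  simp [Gop]

theorem Gop_smul_add (R : ℂ → (H →L[ℂ] D)) (τ : D →L[ℂ] X) (z a : ℂ) (ℓ₁ ℓ₂ : X →L[ℂ] ℂ) :
    Gop R τ z (a • ℓ₁ + ℓ₂) = conj a • Gop R τ z ℓ₁ + Gop R τ z ℓ₂ := by
  refine ext_inner_right ℂ fun h => ?_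
  simp [inner_Gop, inner_add_left, inner_smul_left]

theorem norm_Gop_le (R : ℂ → (H →L[ℂ] D)) (τ : D →L[ℂ] X) (z : ℂ) (ℓ : X →L[ℂ] ℂ) :
    ‖Gop R τ z ℓ‖ ≤ ‖τ.comp (R (conj z))‖ * ‖ℓ‖ := by
  rw [Gop, LinearIsometryEquiv.norm_map, mul_comm]
  exact ContinuousLinearMap.opNorm_comp_le _ _

/-- The resolvent identity for `Gop`. -/
theorem Gop_sub_Gop {ρ : Set ℂ} {R : ℂ → (H →L[ℂ] D)} {ι : D →L[ℂ] H} (τ : D →L[ℂ] X)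
    (hρ : ∀ z ∈ ρ, conj z ∈ ρ)
    (hres : ∀ z ∈ ρ, ∀ w ∈ ρ, (z - w) • ((R w).comp (ι.comp (R z))) = R w - R z)
    (hadj : ∀ z ∈ ρ, ContinuousLinearMap.adjoint (ι.comp (R z)) = ι.comp (R (conj z)))
    {z w : ℂ} (hz : z ∈ ρ) (hw : w ∈ ρ) (ℓ : X →L[ℂ] ℂ) :
    Gop R τ w ℓ - Gop R τ z ℓ = ι ((z - w) • R w (Gop R τ z ℓ)) := by
  refine ext_inner_right ℂ fun h => ?_
  have hsymm : inner ℂ (ι (R w (Gop R τ z ℓ))) h =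
      inner ℂ (Gop R τ z ℓ) (ι (R (conj w) h)) := by
    have := ContinuousLinearMap.adjoint_inner_right (ι.comp (R w)) (Gop R τ z ℓ) h
    rw [hadj w hw] at this
    exact this.symm
  have hR : R (conj w) h - R (conj z) h =
      conj (z - w) • R (conj z) (ι (R (conj w) h)) := by
    have h' := congrArg (fun T : H →L[ℂ] D => T h) (hres _ (hρ w hw) _ (hρ z hz))
    simp only [smul_apply, ContinuousLinearMap.comp_apply,
      sub_apply] at h'
    rw [← neg_sub (R (conj z) h), ← h', ← neg_smul, neg_sub, map_sub]
  rw [map_smul, inner_smul_left, hsymm, inner_sub_left, inner_Gop, inner_Gop, inner_Gop,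
    ← map_sub, ← map_sub, hR, map_smul, map_smul, smul_eq_mul]

end Gop

/-- Fix `z₀ ∈ ρ(A)` and set `Γ̂(z) := τ ∘ ((G(z₀)+G(z₀*))/2 − G(z))`.
(The operator `(G(z₀)+G(z₀*))/2 − G(z)` takes values in `D(A)`; `lift` is that map
viewed into `D(A)`, so `Γ̂(z)ℓ = τ (lift z ℓ)`.)  Then `Γ̂` is a family of bounded
conjugate-linear operators `X′ → X` satisfying
`Γ̂(z) − Γ̂(w) = (z − w) • Ğ(w) ∘ G(z)` for all `z, w ∈ ρ(A)`. -/
theorem stmt4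
    {H : Type*} [NormedAddCommGroup H] [InnerProductSpace ℂ H] [CompleteSpace H]
    {D : Type*} [NormedAddCommGroup D] [NormedSpace ℂ D]
    {X : Type*} [NormedAddCommGroup X] [NormedSpace ℂ X]
    (ρ : Set ℂ) (R : ℂ → (H →L[ℂ] D)) (ι : D →L[ℂ] H) (τ : D →L[ℂ] X)
    (hιinj : Function.Injective ι)
    (hρ : ∀ z ∈ ρ, conj z ∈ ρ)
    (hres : ∀ z ∈ ρ, ∀ w ∈ ρ,
      (z - w) • ((R w).comp (ι.comp (R z))) = R w - R z)
    (hadj : ∀ z ∈ ρ,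
      ContinuousLinearMap.adjoint (ι.comp (R z)) = ι.comp (R (conj z)))
    {z₀ : ℂ} (hz₀ : z₀ ∈ ρ)
    (lift : ℂ → (X →L[ℂ] ℂ) → D)
    (hlift : ∀ u ∈ ρ, ∀ ℓ : X →L[ℂ] ℂ,
      ι (lift u ℓ) = (2 : ℂ)⁻¹ • (Gop R τ z₀ ℓ + Gop R τ (conj z₀) ℓ) - Gop R τ u ℓ)
    {z w : ℂ} (hz : z ∈ ρ) (hw : w ∈ ρ) :
    -- the Kreĭn-type difference identity Γ̂(z) − Γ̂(w) = (z−w)·Ğ(w)∘G(z)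
    (∀ ℓ : X →L[ℂ] ℂ,
      τ (lift z ℓ) - τ (lift w ℓ) = (z - w) • τ (R w (Gop R τ z ℓ))) ∧
    -- Γ̂(z) is bounded
    (∃ C : ℝ, ∀ ℓ : X →L[ℂ] ℂ, ‖τ (lift z ℓ)‖ ≤ C * ‖ℓ‖) ∧
    -- Γ̂(z) is conjugate-linear
    (∀ (a : ℂ) (ℓ₁ ℓ₂ : X →L[ℂ] ℂ),
      τ (lift z (a • ℓ₁ + ℓ₂)) = conj a • τ (lift z ℓ₁) + τ (lift z ℓ₂)) := by
  have hdiff : ∀ u ∈ ρ, ∀ v ∈ ρ, ∀ ℓ : X →L[ℂ] ℂ,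
      Gop R τ v ℓ - Gop R τ u ℓ = ι ((u - v) • R v (Gop R τ u ℓ)) :=
    fun u hu v hv ℓ => Gop_sub_Gop τ hρ hres hadj hu hv ℓ
  have hlift_eq : ∀ ℓ : X →L[ℂ] ℂ, lift z ℓ =
      (2 : ℂ)⁻¹ • ((z - z₀) • R z₀ (Gop R τ z ℓ) +
        (z - conj z₀) • R (conj z₀) (Gop R τ z ℓ)) := by
    intro ℓ
    apply hιinj
    rw [hlift z hz, map_smul, map_add, ← hdiff z hz z₀ hz₀, ← hdiff z hz _ (hρ z₀ hz₀)]
    module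
  let S : H →L[ℂ] X :=
    τ.comp ((2 : ℂ)⁻¹ • ((z - z₀) • R z₀ + (z - conj z₀) • R (conj z₀)))
  have hS : ∀ ℓ : X →L[ℂ] ℂ, τ (lift z ℓ) = S (Gop R τ z ℓ) := fun ℓ => by
    rw [hlift_eq]
    rfl
  refine ⟨fun ℓ => ?_, ⟨‖S‖ * ‖τ.comp (R (conj z))‖, fun ℓ => ?_⟩, fun a ℓ₁ ℓ₂ => ?_⟩
  · have hsub : lift z ℓ - lift w ℓ = (z - w) • R w (Gop R τ z ℓ) := by
      apply hιinj
      rw [← hdiff z hz w hw, map_sub, hlift z hz, hlift w hw]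
      abel
    rw [← map_sub, hsub, map_smul]
  · rw [hS, mul_assoc]
    exact S.le_opNorm_of_le (norm_Gop_le R τ z ℓ)
  · rw [hS, hS, hS, Gop_smul_add, map_add, map_smul]
end

section
/- For z ∈ ℂ with Re√z > 0 and y ≠ ỹ points of ℝ³, the following hold: (i) ⟨G_{z*}^y, G_z^y⟩_{L²(ℝ³)} = 1/(8π√z), and (ii) ⟨G_{z*}^{ỹ}, G_z^y⟩_{L²(ℝ³)} = e^{−√z|ỹ−y|}/(8π√z), where G_z^y(x) := e^{−√z|x−y|}/(4π|x−y|) is the free resolvent kernel of the Laplacian in dimension 3. -/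
open scoped ComplexConjugate
open MeasureTheory Real

/-- The free resolvent kernel of the Laplacian in three dimensions:
`G_z^y(x) = e^{−√z |x−y|} / (4π |x−y|)`, with the principal branch `√z = z^{1/2}`. -/
noncomputable def resKernel (z : ℂ) (y x : EuclideanSpace ℝ (Fin 3)) : ℂ :=
  Complex.exp (-(z ^ (1/2 : ℂ)) * (‖x - y‖ : ℂ)) / (4 * (π : ℂ) * (‖x - y‖ : ℂ))

open Set
open scoped ENNReal

/-- Polar coordinates for a function of the squared distance to the origin in the plane. -/
theorem lintegral_sq_add_sq {F : ℝ → ℝ≥0∞} (hF : Measurable F) :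
    ∫⁻ q : ℝ × ℝ, F (q.1 ^ 2 + q.2 ^ 2) = ENNReal.ofReal π * ∫⁻ p in Ioi (0 : ℝ), F p := by
  have himg : (fun r : ℝ => r ^ 2) '' Ioi 0 = Ioi 0 := by
    ext p
    constructor
    · rintro ⟨r, hr, rfl⟩
      exact pow_pos (mem_Ioi.1 hr) 2
    · intro hp
      exact ⟨√p, Real.sqrt_pos.2 hp, Real.sq_sqrt (le_of_lt hp)⟩
  have hsub : ∫⁻ p in Ioi (0 : ℝ), F p
      = ∫⁻ r in Ioi (0 : ℝ), ENNReal.ofReal |2 * r| * F (r ^ 2) := by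
    conv_lhs => rw [← himg]
    refine lintegral_image_eq_lintegral_abs_deriv_mul measurableSet_Ioi
      (fun r _ => ?_) (fun r hr s hs hrs => ?_) F
    · simpa using (hasDerivAt_pow 2 r).hasDerivWithinAt
    · exact (pow_left_inj₀ (le_of_lt hr) (le_of_lt hs) two_ne_zero).1 hrs
  have hpol : ∀ p : ℝ × ℝ, ENNReal.ofReal p.1 •
      F ((polarCoord.symm p).1 ^ 2 + (polarCoord.symm p).2 ^ 2)
        = (ENNReal.ofReal p.1 * F (p.1 ^ 2)) * 1 := by
    intro p
    have : (polarCoord.symm p).1 ^ 2 + (polarCoord.symm p).2 ^ 2 = p.1 ^ 2 := by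
      simp only [polarCoord_symm_apply]
      linear_combination p.1 ^ 2 * Real.sin_sq_add_cos_sq p.2
    rw [this, smul_eq_mul, mul_one]
  rw [← lintegral_comp_polarCoord_symm, polarCoord_target, hsub]
  simp_rw [hpol]
  rw [Measure.volume_eq_prod, ← Measure.prod_restrict,
    lintegral_prod_mul (f := fun r : ℝ => ENNReal.ofReal r * F (r ^ 2)) (g := fun _ => 1)
      (by fun_prop) (by fun_prop)]
  simp only [lintegral_const, Measure.restrict_apply MeasurableSet.univ, univ_inter,
    Real.volume_Ioo, one_mul]
  rw [mul_comm, show π - -π = π * 2 by ring, ENNReal.ofReal_mul Real.pi_pos.le, mul_assoc,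
    ← lintegral_const_mul _ (by fun_prop)]
  congr 1
  refine setLIntegral_congr_fun measurableSet_Ioi fun r hr => ?_
  have hr : 0 < r := hr
  rw [abs_of_pos (by positivity), ENNReal.ofReal_mul (by norm_num), mul_assoc]

/-- Cylindrical coordinates for an axially symmetric function in space, with the squared
distance to the axis as radial variable. -/
theorem lintegral_axially_symmetric {F : ℝ × ℝ → ℝ≥0∞} (hF : Measurable F) :
    ∫⁻ x : EuclideanSpace ℝ (Fin 3), F (x 0, x 1 ^ 2 + x 2 ^ 2)
      = ENNReal.ofReal π * ∫⁻ p in univ ×ˢ Ioi (0 : ℝ), F p := by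
  have e₁ := (EuclideanSpace.volume_preserving_symm_measurableEquiv_toLp (Fin 3)).lintegral_comp_emb
    (MeasurableEquiv.measurableEmbedding _) (fun y : Fin 3 → ℝ => F (y 0, y 1 ^ 2 + y 2 ^ 2))
  have e₂ := (volume_preserving_piFinSuccAbove (fun _ : Fin 3 => ℝ) 0).lintegral_comp_emb
    (MeasurableEquiv.measurableEmbedding _)
    (fun y : ℝ × (Fin 2 → ℝ) => F (y.1, y.2 0 ^ 2 + y.2 1 ^ 2))
  have e₃ : ∀ t : ℝ, ∫⁻ y : Fin 2 → ℝ, F (t, y 0 ^ 2 + y 1 ^ 2)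
      = ENNReal.ofReal π * ∫⁻ p in Ioi (0 : ℝ), F (t, p) := by
    intro t
    rw [← lintegral_sq_add_sq (F := fun p => F (t, p)) (by fun_prop)]
    exact (volume_preserving_finTwoArrow ℝ).lintegral_comp_emb
      (MeasurableEquiv.measurableEmbedding _) (fun q : ℝ × ℝ => F (t, q.1 ^ 2 + q.2 ^ 2))
  refine e₁.trans (e₂.trans ?_)
  rw [Measure.volume_eq_prod, lintegral_prod _ (by fun_prop)]
  simp_rw [e₃]
  rw [lintegral_const_mul _ (by fun_prop), Measure.volume_eq_prod, ← Measure.prod_restrict,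
    Measure.restrict_univ, lintegral_prod _ (by fun_prop)]

/-- The position on the axis and the squared distance to the axis, in terms of the sum and
difference of the distances to the two foci `0` and `a` on the axis. -/
noncomputable def ofFocalSumDiff (a : ℝ) (q : ℝ × ℝ) : ℝ × ℝ :=
  ((q.1 * q.2 + a ^ 2) / (2 * a), (q.1 ^ 2 - a ^ 2) * (a ^ 2 - q.2 ^ 2) / (4 * a ^ 2))

theorem ofFocalSumDiff_dist_zero {a : ℝ} (ha : a ≠ 0) (q : ℝ × ℝ) :
    (ofFocalSumDiff a q).1 ^ 2 + (ofFocalSumDiff a q).2 = ((q.1 + q.2) / 2) ^ 2 := by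
  simp only [ofFocalSumDiff]
  field_simp
  ring

theorem ofFocalSumDiff_dist_self {a : ℝ} (ha : a ≠ 0) (q : ℝ × ℝ) :
    ((ofFocalSumDiff a q).1 - a) ^ 2 + (ofFocalSumDiff a q).2 = ((q.1 - q.2) / 2) ^ 2 := by
  simp only [ofFocalSumDiff]
  field_simp
  ring

theorem injOn_ofFocalSumDiff {a : ℝ} (ha : 0 < a) :
    InjOn (ofFocalSumDiff a) (Ioi a ×ˢ Ioo (-a) a) := by
  rintro q ⟨hq₁, hq₂, hq₃⟩ q' ⟨hq'₁, hq'₂, hq'₃⟩ h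
  simp only [mem_Ioi] at hq₁ hq'₁
  have h₁ := ofFocalSumDiff_dist_zero ha.ne' q
  have h₂ := ofFocalSumDiff_dist_self ha.ne' q
  rw [h, ofFocalSumDiff_dist_zero ha.ne', sq_eq_sq₀ (by linarith) (by linarith)] at h₁
  rw [h, ofFocalSumDiff_dist_self ha.ne', sq_eq_sq₀ (by linarith) (by linarith)] at h₂
  ext <;> linarith

theorem image_ofFocalSumDiff {a : ℝ} (ha : 0 < a) :
    ofFocalSumDiff a '' (Ioi a ×ˢ Ioo (-a) a) = univ ×ˢ Ioi 0 := by
  ext ⟨t, p⟩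
  simp only [mem_image, mem_prod, mem_univ, true_and, mem_Ioi, mem_Ioo]
  constructor
  · rintro ⟨⟨u, v⟩, ⟨hu, hv₁, hv₂⟩, h⟩
    simp only [ofFocalSumDiff, Prod.mk.injEq] at h hu hv₁ hv₂
    rw [← h.2]
    have h₁ : 0 < u ^ 2 - a ^ 2 := by nlinarith
    have h₂ : 0 < a ^ 2 - v ^ 2 := by nlinarith
    positivity
  · intro hp
    have hr := Real.sq_sqrt (show 0 ≤ t ^ 2 + p by positivity)
    have hs := Real.sq_sqrt (show 0 ≤ (t - a) ^ 2 + p by positivity)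
    have hr₀ : |t| < √(t ^ 2 + p) := Real.lt_sqrt_of_sq_lt (by rw [sq_abs]; linarith)
    have hs₀ : |t - a| < √((t - a) ^ 2 + p) := Real.lt_sqrt_of_sq_lt (by rw [sq_abs]; linarith)
    set r := √(t ^ 2 + p)
    set s := √((t - a) ^ 2 + p)
    have hsum : a < r + s := by
      linarith [le_abs_self t, neg_abs_le (t - a)]
    have hdiff : (r - s) * (r + s) = (2 * t - a) * a := by linear_combination hr - hs
    have habs : |2 * t - a| < r + s := by
      refine lt_of_le_of_lt ?_ (add_lt_add hr₀ hs₀)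
      rw [show 2 * t - a = t + (t - a) by ring]
      exact abs_add_le _ _
    have hd : |r - s| < a := by
      have h : |r - s| * (r + s) < a * (r + s) := by
        have := congrArg abs hdiff
        rw [abs_mul, abs_mul, abs_of_pos ha, abs_of_pos (ha.trans hsum)] at this
        rw [this, mul_comm a]
        exact mul_lt_mul_of_pos_right habs ha
      exact lt_of_mul_lt_mul_right h (ha.trans hsum).le
    refine ⟨(r + s, r - s), ⟨hsum, abs_lt.1 hd⟩, ?_⟩
    have h₁ : ((r + s) * (r - s) + a ^ 2) / (2 * a) = t := by
      field_simp
      linear_combination hdiff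
    have h₂ := ofFocalSumDiff_dist_zero ha.ne' (r + s, r - s)
    refine Prod.ext h₁ ?_
    have h₃ : (ofFocalSumDiff a (r + s, r - s)).1 = t := h₁
    rw [h₃] at h₂
    simp only at h₂ ⊢
    linear_combination h₂ + hr

/-- The derivative of `ofFocalSumDiff a`. -/
noncomputable def fderivOfFocalSumDiff (a : ℝ) (q : ℝ × ℝ) : ℝ × ℝ →L[ℝ] ℝ × ℝ :=
  (Matrix.toLin (.finTwoProd ℝ) (.finTwoProd ℝ)
    !![q.2 / (2 * a), q.1 / (2 * a);
      2 * q.1 * (a ^ 2 - q.2 ^ 2) / (4 * a ^ 2),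
      -(2 * q.2 * (q.1 ^ 2 - a ^ 2)) / (4 * a ^ 2)]).toContinuousLinearMap

theorem hasFDerivAt_ofFocalSumDiff (a : ℝ) (q : ℝ × ℝ) :
    HasFDerivAt (ofFocalSumDiff a) (fderivOfFocalSumDiff a q) q := by
  unfold fderivOfFocalSumDiff
  rw [Matrix.toLin_finTwoProd_toContinuousLinearMap]
  have h₁ : HasFDerivAt (fun q : ℝ × ℝ => q.1) (ContinuousLinearMap.fst ℝ ℝ ℝ) q := hasFDerivAt_fst
  have h₂ : HasFDerivAt (fun q : ℝ × ℝ => q.2) (ContinuousLinearMap.snd ℝ ℝ ℝ) q := hasFDerivAt_snd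
  refine (HasFDerivAt.prodMk (((h₁.mul h₂).add_const (a ^ 2)).mul_const (2 * a)⁻¹)
    ((((h₁.pow 2).sub_const (a ^ 2)).mul ((h₂.pow 2).const_sub (a ^ 2))).mul_const
      (4 * a ^ 2)⁻¹)).congr_fderiv ?_
  ext <;> simp <;> ring

theorem det_fderivOfFocalSumDiff {a : ℝ} (ha : a ≠ 0) (q : ℝ × ℝ) :
    (fderivOfFocalSumDiff a q).det = -((q.1 ^ 2 - q.2 ^ 2) / (4 * a)) := by
  simp only [fderivOfFocalSumDiff, ContinuousLinearMap.det, LinearMap.coe_toContinuousLinearMap,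
    LinearMap.det_toLin, Matrix.det_fin_two_of]
  field_simp
  ring

theorem lintegral_comp_ofFocalSumDiff {a : ℝ} (ha : 0 < a) (F : ℝ × ℝ → ℝ≥0∞) :
    ∫⁻ p in univ ×ˢ Ioi (0 : ℝ), F p = ∫⁻ q in Ioi a ×ˢ Ioo (-a) a,
      ENNReal.ofReal ((q.1 ^ 2 - q.2 ^ 2) / (4 * a)) * F (ofFocalSumDiff a q) := by
  have hm : MeasurableSet (Ioi a ×ˢ Ioo (-a) a) := measurableSet_Ioi.prod measurableSet_Ioo
  rw [← image_ofFocalSumDiff ha, lintegral_image_eq_lintegral_abs_det_fderiv_mul volume hm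
    (fun q _ => (hasFDerivAt_ofFocalSumDiff a q).hasFDerivWithinAt) (injOn_ofFocalSumDiff ha)]
  refine setLIntegral_congr_fun hm fun q hq => ?_
  obtain ⟨h₁, h₂, h₃⟩ := hq
  simp only [mem_Ioi] at h₁
  have : 0 < q.1 ^ 2 - q.2 ^ 2 := by nlinarith
  rw [det_fderivOfFocalSumDiff ha.ne', abs_neg, abs_of_pos (by positivity)]

/-- Integration against `1 / (|x| |x - v|)` of a function of `|x| + |x - v|`, for `v` on the
first coordinate axis. -/
theorem lintegral_focal_sum_single {a : ℝ} (ha : 0 < a) {h : ℝ → ℝ≥0∞} (hh : Measurable h) :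
    ∫⁻ x : EuclideanSpace ℝ (Fin 3),
        ENNReal.ofReal ((‖x‖ * ‖x - EuclideanSpace.single 0 a‖)⁻¹) *
          h (‖x‖ + ‖x - EuclideanSpace.single 0 a‖)
      = ENNReal.ofReal (2 * π) * ∫⁻ u in Ioi a, h u := by
  let F : ℝ × ℝ → ℝ≥0∞ := fun p =>
    ENNReal.ofReal ((√(p.1 ^ 2 + p.2) * √((p.1 - a) ^ 2 + p.2))⁻¹) *
      h (√(p.1 ^ 2 + p.2) + √((p.1 - a) ^ 2 + p.2))
  have hF : Measurable F := by
    refine Measurable.mul (by fun_prop) (hh.comp (by fun_prop))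
  have hn : ∀ x : EuclideanSpace ℝ (Fin 3), ‖x‖ = √(x 0 ^ 2 + (x 1 ^ 2 + x 2 ^ 2)) := by
    intro x
    simp [EuclideanSpace.norm_eq, Fin.sum_univ_three, add_assoc]
  have hn' : ∀ x : EuclideanSpace ℝ (Fin 3), ‖x - EuclideanSpace.single 0 a‖
      = √((x 0 - a) ^ 2 + (x 1 ^ 2 + x 2 ^ 2)) := by
    intro x
    rw [hn]
    simp
  have hm : MeasurableSet (Ioi a ×ˢ Ioo (-a) a) := measurableSet_Ioi.prod measurableSet_Ioo
  have hFq : ∀ q ∈ Ioi a ×ˢ Ioo (-a) a,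
      ENNReal.ofReal ((q.1 ^ 2 - q.2 ^ 2) / (4 * a)) * F (ofFocalSumDiff a q)
        = h q.1 * ENNReal.ofReal a⁻¹ := by
    rintro q ⟨h₁, h₂, h₃⟩
    simp only [mem_Ioi] at h₁
    simp only [F]
    rw [ofFocalSumDiff_dist_zero ha.ne', ofFocalSumDiff_dist_self ha.ne',
      Real.sqrt_sq (by linarith), Real.sqrt_sq (by linarith), ← mul_assoc,
      ← ENNReal.ofReal_mul' (inv_nonneg.2 (mul_nonneg (by linarith) (by linarith))), mul_comm]
    have hu : q.1 + q.2 ≠ 0 := by linarith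
    have hv : q.1 - q.2 ≠ 0 := by linarith
    congr 2
    · ring
    · field_simp
      ring
  calc _ = ∫⁻ x : EuclideanSpace ℝ (Fin 3), F (x 0, x 1 ^ 2 + x 2 ^ 2) := by
        simp_rw [hn', hn]
        rfl
    _ = _ := by
        rw [lintegral_axially_symmetric hF, lintegral_comp_ofFocalSumDiff ha,
          setLIntegral_congr_fun hm hFq, Measure.volume_eq_prod, ← Measure.prod_restrict,
          lintegral_prod_mul (f := h) (g := fun _ => ENNReal.ofReal a⁻¹)
            (by fun_prop) (by fun_prop)]
        simp only [lintegral_const, Measure.restrict_apply MeasurableSet.univ, univ_inter,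
          Real.volume_Ioo]
        rw [← ENNReal.ofReal_mul (by positivity), mul_comm (lintegral _ _), ← mul_assoc,
          ← ENNReal.ofReal_mul Real.pi_pos.le]
        congr 2
        field_simp
        ring

/-- Integration against `1 / (|x| |x - v|)` of a function of `|x| + |x - v|`. -/
theorem lintegral_focal_sum {v : EuclideanSpace ℝ (Fin 3)} (hv : v ≠ 0) {h : ℝ → ℝ≥0∞}
    (hh : Measurable h) :
    ∫⁻ x, ENNReal.ofReal ((‖x‖ * ‖x - v‖)⁻¹) * h (‖x‖ + ‖x - v‖)
      = ENNReal.ofReal (2 * π) * ∫⁻ u in Ioi ‖v‖, h u := by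
  set w : EuclideanSpace ℝ (Fin 3) := EuclideanSpace.single 0 ‖v‖ with hw
  have hvw : ‖v‖ = ‖w‖ := by simp [hw]
  let R := (ℝ ∙ (v - w))ᗮ.reflection
  have hR : R v = w := Submodule.reflection_sub hvw
  rw [← lintegral_focal_sum_single (norm_pos_iff.2 hv) hh, ← hw]
  symm
  rw [← R.measurePreserving.lintegral_comp_emb R.toHomeomorph.measurableEmbedding]
  refine lintegral_congr fun x => ?_
  have hx : ‖R x - w‖ = ‖x - v‖ := by rw [← hR, ← map_sub, R.norm_map]
  rw [hx, R.norm_map]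

/-- Bochner integration against `1 / (|x| |x - v|)` of a function of `|x| + |x - v|`. -/
theorem integral_focal_sum (v : EuclideanSpace ℝ (Fin 3)) {h : ℝ → ℂ} (hh : Continuous h) :
    ∫ x : EuclideanSpace ℝ (Fin 3), (‖x‖ * ‖x - v‖)⁻¹ • h (‖x‖ + ‖x - v‖)
      = (2 * π) • ∫ u in Ioi ‖v‖, h u := by
  rcases eq_or_ne v 0 with rfl | hv
  · have hball : volume.real (Metric.ball (0 : EuclideanSpace ℝ (Fin 3)) 1) = π * 4 / 3 := by
      rw [Measure.real, EuclideanSpace.volume_ball_fin_three]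
      simp only [ENNReal.ofReal_one, one_pow, one_mul]
      exact ENNReal.toReal_ofReal (by positivity)
    have hrad := integral_fun_norm_addHaar (volume : Measure (EuclideanSpace ℝ (Fin 3)))
      (fun r => (r * r)⁻¹ • h (r + r))
    simp only [sub_zero, norm_zero]
    rw [hrad, hball, finrank_euclideanSpace_fin]
    have hint : ∫ r in Ioi (0 : ℝ), r ^ (3 - 1) • (r * r)⁻¹ • h (r + r)
        = (2 : ℝ)⁻¹ • ∫ u in Ioi (0 : ℝ), h u := by
      have := integral_comp_mul_left_Ioi h 0 (b := 2) two_pos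
      rw [mul_zero] at this
      rw [← this]
      refine setIntegral_congr_fun measurableSet_Ioi fun r hr => ?_
      have hr : r ≠ 0 := ne_of_gt hr
      rw [smul_smul, two_mul, show r ^ (3 - 1) * (r * r)⁻¹ = 1 by field_simp, one_smul]
    rw [hint, smul_smul, ← Nat.cast_smul_eq_nsmul ℝ, smul_smul]
    congr 1
    push_cast
    ring
  · let U : EuclideanSpace ℝ (Fin 3) → ℝ := fun x => ‖x‖ + ‖x - v‖
    let W : EuclideanSpace ℝ (Fin 3) → ℝ≥0∞ := fun x => ENNReal.ofReal ((‖x‖ * ‖x - v‖)⁻¹)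
    have hU : Measurable U := by fun_prop
    have hW : Measurable W := by fun_prop
    have hmap : (volume.withDensity W).map U
        = ENNReal.ofReal (2 * π) • volume.restrict (Ioi ‖v‖) := by
      refine Measure.ext_of_lintegral _ fun f hf => ?_
      rw [lintegral_map hf hU,
        lintegral_withDensity_eq_lintegral_mul _ hW (g := fun x => f (U x)) (hf.comp hU),
        lintegral_smul_measure, smul_eq_mul, ← lintegral_focal_sum hv hf]
      rfl
    calc _ = ∫ x, (W x).toReal • h (U x) := by
          refine integral_congr_ae (.of_forall fun x => ?_)
          simp only [W, U]
          rw [ENNReal.toReal_ofReal (by positivity)]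
      _ = ∫ x, h (U x) ∂volume.withDensity W :=
          (integral_withDensity_eq_integral_toReal_smul hW
            (.of_forall fun _ => ENNReal.ofReal_lt_top) _).symm
      _ = ∫ u, h u ∂(volume.withDensity W).map U :=
          (integral_map hU.aemeasurable hh.aestronglyMeasurable).symm
      _ = _ := by
          rw [hmap, integral_smul_measure, ENNReal.toReal_ofReal (by positivity)]

theorem conj_cpow_half {z : ℂ} (hz : z ∈ Complex.slitPlane) :
    conj ((conj z) ^ (1/2 : ℂ)) = z ^ (1/2 : ℂ) := by
  rw [Complex.conj_cpow z _ (Complex.slitPlane_arg_ne_pi hz), Complex.conj_conj]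
  simp only [map_div₀, map_one, map_ofNat]

theorem integral_conj_resKernel_mul_resKernel {z : ℂ} (hz : z ∈ Complex.slitPlane)
    (hre : 0 < (z ^ (1/2 : ℂ)).re) (y y' : EuclideanSpace ℝ (Fin 3)) :
    (∫ x : EuclideanSpace ℝ (Fin 3), conj (resKernel (conj z) y' x) * resKernel z y x)
      = Complex.exp (-(z ^ (1/2 : ℂ)) * (‖y' - y‖ : ℂ)) / (8 * (π : ℂ) * z ^ (1/2 : ℂ)) := by
  have hconj := conj_cpow_half hz
  have hπ : (π : ℂ) ≠ 0 := Complex.ofReal_ne_zero.2 Real.pi_ne_zero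
  unfold resKernel
  set w := z ^ (1/2 : ℂ)
  have hw : w ≠ 0 := by
    rintro hw
    simp [hw] at hre
  have hpt : ∀ x : EuclideanSpace ℝ (Fin 3),
      conj (Complex.exp (-((conj z) ^ (1/2 : ℂ)) * (‖x - y'‖ : ℂ)) / (4 * π * (‖x - y'‖ : ℂ)))
        * (Complex.exp (-w * (‖x - y‖ : ℂ)) / (4 * π * (‖x - y‖ : ℂ)))
      = (16 * π ^ 2 : ℂ)⁻¹ * ((‖x - y‖ * ‖(x - y) - (y' - y)‖)⁻¹ •
          Complex.exp (-w * ((‖x - y‖ + ‖(x - y) - (y' - y)‖ : ℝ) : ℂ))) := by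
    intro x
    rw [sub_sub_sub_cancel_right, map_div₀, ← Complex.exp_conj, map_mul, map_neg, hconj,
      Complex.real_smul]
    push_cast
    rw [mul_add, Complex.exp_add]
    simp only [map_mul, Complex.conj_ofReal, map_ofNat, div_eq_mul_inv, mul_inv]
    ring
  simp_rw [hpt]
  rw [integral_const_mul, integral_sub_right_eq_self (fun x : EuclideanSpace ℝ (Fin 3) =>
    (‖x‖ * ‖x - (y' - y)‖)⁻¹ • Complex.exp (-w * ((‖x‖ + ‖x - (y' - y)‖ : ℝ) : ℂ))) y,
    integral_focal_sum (y' - y) (h := fun u => Complex.exp (-w * (u : ℂ))) (by fun_prop),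
    integral_exp_mul_complex_Ioi (by simpa using hre), Complex.real_smul]
  push_cast
  field_simp
  norm_num

/-- For `z` off the negative real axis with `Re √z > 0` and points
`y, y' ∈ ℝ³`, one has `⟨G_{z*}^{y'}, G_z^{y}⟩_{L²(ℝ³)} = e^{−√z |y'−y|} / (8π√z)`;
for `y' = y` this is (i) `⟨G_{z*}^y, G_z^y⟩ = 1/(8π√z)`, and for `y' ≠ y` it is (ii). -/
theorem stmt13 (z : ℂ) (hz : z ∈ Complex.slitPlane) (hre : 0 < (z ^ (1/2 : ℂ)).re)
    (y y' : EuclideanSpace ℝ (Fin 3)) :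
    (∫ x : EuclideanSpace ℝ (Fin 3),
        conj (resKernel (conj z) y' x) * resKernel z y x)
      = Complex.exp (-(z ^ (1/2 : ℂ)) * (‖y' - y‖ : ℂ)) / (8 * (π : ℂ) * z ^ (1/2 : ℂ))
    ∧
    (∫ x : EuclideanSpace ℝ (Fin 3),
        conj (resKernel (conj z) y x) * resKernel z y x)
      = 1 / (8 * (π : ℂ) * z ^ (1/2 : ℂ)) := by
  refine ⟨integral_conj_resKernel_mul_resKernel hz hre y y', ?_⟩
  simpa using integral_conj_resKernel_mul_resKernel hz hre y y
end
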